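/- arXiv:1709.01169 — 2 statements merged into one kernel-verified Lean document; each statement's English description precedes it below -/
import Mathlib

section
/- Let F be a finite field of odd order q. Every group automorphism δ of SL₃(F) is a product of a conjugation by a matrix from GL₃(F), possibly the inverse-transpose automorphism x ↦ (xᵀ)⁻¹, and a field automorphism: there exist g ∈ GL₃(F), a field automorphism σ of F, and ε ∈ {0, 1} such that for all x ∈ SL₃(F), δ(x) = g⁻¹ · σ(τᵉ(x)) · g, where τ(x) = (xᵀ)⁻¹ and σ is applied to a matrix entrywise. -/
open Matrix

namespace SL3Aut

variable {F : Type*} [Field F]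

/-- The diagonal involution of `SL₃(F)` with entry `1` in position `i` and `-1` elsewhere. -/
def diagInvolution (i : Fin 3) : SpecialLinearGroup (Fin 3) F :=
  ⟨diagonal fun k ↦ if k = i then 1 else -1, by
    fin_cases i <;> simp [Fin.prod_univ_three]⟩

lemma coe_diagInvolution (i : Fin 3) :
    (diagInvolution i : SpecialLinearGroup (Fin 3) F).1 =
      diagonal fun k ↦ if k = i then 1 else -1 := rfl

lemma diagInvolution_mul_self (i : Fin 3) :
    (diagInvolution i * diagInvolution i : SpecialLinearGroup (Fin 3) F) = 1 := by
  apply SpecialLinearGroup.coeMonoidHom_injective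
  rw [map_mul, map_one, SpecialLinearGroup.coeMonoidHom_apply, coe_diagInvolution,
    diagonal_mul_diagonal, ← diagonal_one]
  congr 1
  ext a
  split_ifs <;> simp

lemma diagInvolution_mul {i j k : Fin 3} (hij : i ≠ j) (hik : i ≠ k) (hjk : j ≠ k) :
    (diagInvolution i * diagInvolution j : SpecialLinearGroup (Fin 3) F) = diagInvolution k := by
  apply SpecialLinearGroup.coeMonoidHom_injective
  simp only [map_mul, SpecialLinearGroup.coeMonoidHom_apply, coe_diagInvolution,
    diagonal_mul_diagonal]
  congr 1
  ext a
  have : a = i ∨ a = j ∨ a = k := by lia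
  rcases this with rfl | rfl | rfl <;>
    simp [hij, hij.symm, hik, hik.symm, hjk, hjk.symm]

lemma diagInvolution_ne_one (h2 : (2 : F) ≠ 0) (i : Fin 3) :
    (diagInvolution i : SpecialLinearGroup (Fin 3) F) ≠ 1 := by
  intro h
  have h' := congrArg (fun x : SpecialLinearGroup (Fin 3) F ↦ x.1 (i + 1) (i + 1)) h
  simp [coe_diagInvolution] at h'
  apply h2
  linear_combination -h'

/-- An involution of determinant one other than the identity has trace `-1`. -/
lemma trace_eq_neg_one {A : Matrix (Fin 3) (Fin 3) F} (hA : A * A = 1) (hdet : A.det = 1)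
    (hne : A ≠ 1) : A.trace = -1 := by
  have hadj : A.adjugate = A := by
    calc A.adjugate = A.adjugate * (A * A) := by rw [hA, mul_one]
      _ = A := by rw [← mul_assoc, adjugate_mul, hdet, one_smul, one_mul]
  rw [adjugate_fin_three] at hadj
  have e := fun i j ↦ congrFun₂ hadj i j
  have m := fun i j ↦ congrFun₂ hA i j
  simp only [mul_apply, Fin.sum_univ_three] at m
  by_contra htr
  rw [trace_fin_three] at htr
  have h1 : A 0 0 + A 1 1 + A 2 2 + 1 ≠ 0 := fun h ↦ htr (by linear_combination h)
  have off : ∀ i j, i ≠ j → A i j = 0 := by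
    intro i j hij
    apply (mul_eq_zero.1 _).resolve_left h1
    have hm := m i j
    have he := e i j
    fin_cases i <;> fin_cases j <;> simp [-mul_eq_zero] at hij hm he ⊢ <;>
      linear_combination hm - he
  have e0 := e 0 0
  have e1 := e 1 1
  have e2 := e 2 2
  have m0 := m 0 0
  have m1 := m 1 1
  have m2 := m 2 2
  simp [off 0 1, off 0 2, off 1 0, off 1 2, off 2 0, off 2 1] at e0 e1 e2 m0 m1 m2
  have key : ∀ a b c : F, a * b = c → a + b + c + 1 ≠ 0 → a * a = 1 → a = 1 := by
    intro a b c h h' ha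
    have : (a + 1) * (b + 1) ≠ 0 := fun h0 ↦ h' (by linear_combination h0 - h)
    apply sub_eq_zero.1
    apply (mul_eq_zero.1 _).resolve_left (left_ne_zero_of_mul this)
    linear_combination ha
  have d0 : A 0 0 = 1 := key _ _ _ e2 h1 m0
  have d1 : A 1 1 = 1 :=
    key _ _ _ (mul_comm (A 1 1) (A 0 0) ▸ e2) (by convert h1 using 1; ring) m1
  have d2 : A 2 2 = 1 :=
    key _ _ _ (mul_comm (A 2 2) (A 0 0) ▸ e1) (by convert h1 using 1; ring) m2
  apply hne
  ext i j
  by_cases hij : i = j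
  · subst hij
    rw [one_apply_eq]
    fin_cases i
    exacts [d0, d1, d2]
  · rw [off i j hij, one_apply_ne hij]

/-- Two commuting involutions of determinant one generating a Klein four-group are simultaneously
conjugate to `diag(1, -1, -1)` and `diag(-1, 1, -1)`. -/
lemma exists_conj_diagInvolution (h2 : (2 : F) ≠ 0) {A B : Matrix (Fin 3) (Fin 3) F}
    (hA : A * A = 1) (hB : B * B = 1) (hAB : A * B = B * A)
    (dA : A.det = 1) (dB : B.det = 1) (nA : A ≠ 1) (nB : B ≠ 1) (nAB : A * B ≠ 1) :
    ∃ Q : GL (Fin 3) F, A * Q.1 = Q.1 * (diagInvolution 0).1 ∧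
      B * Q.1 = Q.1 * (diagInvolution 1).1 := by
  have tA := trace_eq_neg_one hA dA nA
  have tB := trace_eq_neg_one hB dB nB
  have tAB := trace_eq_neg_one (A := A * B)
    (by rw [mul_assoc, ← mul_assoc B, ← hAB, mul_assoc A, hB, mul_one, hA])
    (by rw [det_mul, dA, dB, one_mul]) nAB
  have hv : ∀ s t : F, s * s = 1 → t * t = 1 → 3 - s - t - s * t ≠ 0 →
      ∃ v : Fin 3 → F, v ≠ 0 ∧ A *ᵥ v = s • v ∧ B *ᵥ v = t • v := by
    intro s t hs ht hst
    set P := 1 + s • A + t • B + (s * t) • (A * B) with hP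
    have hP0 : P ≠ 0 := by
      intro h
      have := trace_zero (Fin 3) F
      rw [← h, hP] at this
      simp only [trace_add, trace_smul, tA, tB, tAB, trace_one, Fintype.card_fin] at this
      apply hst
      simp only [smul_eq_mul] at this
      push_cast at this
      linear_combination this
    have hAP : A * P = s • P := by
      simp only [hP, mul_add, mul_one, mul_smul_comm, hA, smul_add, smul_smul, hs,
        ← mul_assoc, one_mul, one_smul]
      abel
    have hBP : B * P = t • P := by
      have : B * (A * B) = A := by rw [← mul_assoc, ← hAB, mul_assoc, hB, mul_one]
      simp only [hP, mul_add, mul_one, mul_smul_comm, hB, this, ← hAB, smul_add, smul_smul, ht,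
        mul_left_comm t s t, one_smul]
      rw [mul_comm t s]
      abel
    obtain ⟨j, hj⟩ : ∃ j, P.col j ≠ 0 := by
      by_contra! h
      exact hP0 (by ext a b; exact congrFun (h b) a)
    refine ⟨P.col j, hj, ?_, ?_⟩
    · ext a
      exact congrFun₂ hAP a j
    · ext a
      exact congrFun₂ hBP a j
  have h4 : (4 : F) ≠ 0 := by
    rw [show (4 : F) = 2 * 2 by norm_num]
    exact mul_ne_zero h2 h2
  obtain ⟨v₀, n₀, a₀, b₀⟩ := hv 1 (-1) (by ring) (by ring) (by convert h4 using 1; ring)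
  obtain ⟨v₁, n₁, a₁, b₁⟩ := hv (-1) 1 (by ring) (by ring) (by convert h4 using 1; ring)
  obtain ⟨v₂, n₂, a₂, b₂⟩ := hv (-1) (-1) (by ring) (by ring) (by convert h4 using 1; ring)
  set Q : Matrix (Fin 3) (Fin 3) F := (of ![v₀, v₁, v₂])ᵀ with hQ
  have hAQ : A * Q = Q * (diagInvolution 0).1 := by
    ext a b
    rw [coe_diagInvolution, mul_diagonal]
    fin_cases b
    · simpa [hQ, mul_apply, mulVec, dotProduct] using congrFun a₀ a
    · simpa [hQ, mul_apply, mulVec, dotProduct] using congrFun a₁ a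
    · simpa [hQ, mul_apply, mulVec, dotProduct] using congrFun a₂ a
  have hBQ : B * Q = Q * (diagInvolution 1).1 := by
    ext a b
    rw [coe_diagInvolution, mul_diagonal]
    fin_cases b
    · simpa [hQ, mul_apply, mulVec, dotProduct] using congrFun b₀ a
    · simpa [hQ, mul_apply, mulVec, dotProduct] using congrFun b₁ a
    · simpa [hQ, mul_apply, mulVec, dotProduct] using congrFun b₂ a
  have hdet : Q.det ≠ 0 := by
    intro h
    obtain ⟨c, hc, hQc⟩ := exists_mulVec_eq_zero_iff.2 h
    have hAc : Q *ᵥ ((diagInvolution 0).1 *ᵥ c) = 0 := by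
      rw [mulVec_mulVec, ← hAQ, ← mulVec_mulVec, hQc, mulVec_zero]
    have hBc : Q *ᵥ ((diagInvolution 1).1 *ᵥ c) = 0 := by
      rw [mulVec_mulVec, ← hBQ, ← mulVec_mulVec, hQc, mulVec_zero]
    simp only [hQ, coe_diagInvolution, funext_iff, mulVec, dotProduct,
      Fin.sum_univ_three] at hQc hAc hBc
    simp at hQc hAc hBc
    have cancel : ∀ (x : F) (v : Fin 3 → F), v ≠ 0 → (∀ a, 2 * (v a * x) = 0) → x = 0 := by
      intro x v hv hx
      obtain ⟨a, ha⟩ := Function.ne_iff.1 hv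
      exact ((mul_eq_zero.1 ((mul_eq_zero.1 (hx a)).resolve_left h2)).resolve_left ha)
    have c0 := cancel (c 0) v₀ n₀ fun a ↦ by linear_combination hQc a + hAc a
    have c1 := cancel (c 1) v₁ n₁ fun a ↦ by linear_combination hQc a + hBc a
    have c2 := cancel (c 2) v₂ n₂ fun a ↦ by linear_combination - hAc a - hBc a
    apply hc
    ext a
    fin_cases a
    exacts [c0, c1, c2]
  exact ⟨GeneralLinearGroup.mkOfDetNeZero Q hdet, hAQ, hBQ⟩

lemma sum_eq_of_distinct {i j k : Fin 3} (hij : i ≠ j) (hik : i ≠ k) (hjk : j ≠ k) (f : Fin 3 → F) :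
    ∑ a, f a = f i + f j + f k := by
  rw [show (Finset.univ : Finset (Fin 3)) = {i, j, k} by revert i j k; decide]
  rw [Finset.sum_insert (by simp [hij, hik]), Finset.sum_pair hjk, add_assoc]

lemma transvection_mul_transvection_of_ne {i j k : Fin 3} (hik : i ≠ k) (hjk : j ≠ k)
    (c d : F) : transvection i j c * transvection j k d =
      transvection i k (c * d) * (transvection j k d * transvection i j c) := by
  simp [transvection, mul_add, add_mul, hik.symm, hjk.symm]
  abel

lemma commute_transvection_same_row {i j k : Fin 3} (hij : i ≠ j) (hik : i ≠ k)
    (c d : F) : transvection i j c * transvection i k d =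
      transvection i k d * transvection i j c := by
  simp [transvection, mul_add, add_mul, hij.symm, hik.symm]
  abel

lemma commute_transvection_same_col {i j k : Fin 3} (hij : i ≠ j) (hjk : j ≠ k)
    (c d : F) : transvection i j c * transvection k j d =
      transvection k j d * transvection i j c := by
  simp [transvection, mul_add, add_mul, hij.symm, hjk]
  abel

lemma eq_zero_of_commute_transvection {i j k : Fin 3} (hij : i ≠ j) (hik : i ≠ k) (hjk : j ≠ k)
    {c d : F} (h : transvection i j c * transvection j k d =
      transvection j k d * transvection i j c) : c * d = 0 := by
  have := congrFun₂ h i k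
  simpa [transvection, mul_add, add_mul, hij, hik, hjk, hij.symm, hik.symm, hjk.symm] using this

lemma transvection_pow {i j : Fin 3} (hij : i ≠ j) (c : F) (n : ℕ) :
    transvection i j c ^ n = transvection i j (n * c) := by
  induction n with
  | zero => simp
  | succ n ih =>
    rw [pow_succ, ih, transvection_mul_transvection_same _ _ hij]
    push_cast
    congr 1
    ring

lemma diag2n_eq_prod_transvection {i j : Fin 3} (hij : i ≠ j) {a : F} (ha : a ≠ 0) :
    SpecialLinearGroup.diag2n hij a ha =
      SpecialLinearGroup.transvection hij a * SpecialLinearGroup.transvection hij.symm (-a⁻¹) *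
      SpecialLinearGroup.transvection hij (a - 1) * SpecialLinearGroup.transvection hij.symm 1 *
      SpecialLinearGroup.transvection hij (-1) := by
  apply SpecialLinearGroup.coeMonoidHom_injective
  simp only [map_mul, SpecialLinearGroup.coeMonoidHom_apply, SpecialLinearGroup.transvection_coe,
    SpecialLinearGroup.diag2n_coe]
  ext r s
  simp [mul_add, add_mul, hij, hij.symm]
  simp [single_apply, diagonal_apply, one_apply]
  split_ifs <;> grind

/-- A unipotent matrix of determinant one commuting with the `k`-th diagonal involution and
inverted by the `i`-th one is a transvection. -/
lemma eq_transvection_or_eq_transvection (h2 : (2 : F) ≠ 0) {p : ℕ} [Fact p.Prime] [CharP F p]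
    {i j k : Fin 3} (hij : i ≠ j) (hik : i ≠ k) (hjk : j ≠ k) {M : Matrix (Fin 3) (Fin 3) F}
    (hdet : M.det = 1) (hp : M ^ p = 1) {D : Fin 3 → Matrix (Fin 3) (Fin 3) F}
    (hD : ∀ l, D l = diagonal fun r ↦ if r = l then 1 else -1)
    (hk : D k * M = M * D k) (hi : M * D i * M = D i) :
    (∃ c, M = transvection i j c) ∨ ∃ c, M = transvection j i c := by
  have hz : ∀ r, r ≠ k → M r k = 0 ∧ M k r = 0 := by
    intro r hr
    have h1 := congrFun₂ hk r k
    have h2' := congrFun₂ hk k r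
    simp only [hD, diagonal_mul, mul_diagonal, hr, if_true, if_false] at h1 h2'
    exact ⟨(mul_eq_zero.1 (by linear_combination -h1)).resolve_left h2,
      (mul_eq_zero.1 (by linear_combination h2')).resolve_left h2⟩
  obtain ⟨zik, zki⟩ := hz i hik
  obtain ⟨zjk, zkj⟩ := hz j hjk
  have htr : M i i + M j j + M k k = 3 := by
    have hnil : IsNilpotent (M - 1) :=
      ⟨p, by rw [sub_pow_char_of_commute p (Commute.one_right M), hp, one_pow, sub_self]⟩
    have := (isNilpotent_trace_of_isNilpotent hnil).eq_zero
    rw [trace_sub, trace_one, trace, sum_eq_of_distinct hij hik hjk] at this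
    simp only [diag_apply, Fintype.card_fin] at this
    push_cast at this
    linear_combination this
  have hd : M k k * (M i i * M j j - M i j * M j i) = 1 := by
    rw [← hdet, det_fin_three]
    clear hdet hp hk hi htr hz hD
    fin_cases i <;> fin_cases j <;> fin_cases k <;> simp at * <;> simp [*] <;> ring
  have e : ∀ r s, M r i * M i s - M r j * M j s - M r k * M k s = D i r s := by
    intro r s
    rw [← hi, mul_apply, sum_eq_of_distinct hij hik hjk, hD]
    simp [mul_diagonal, hij.symm, hik.symm]
    ring
  have eii := e i i
  have eij := e i j
  have eji := e j i
  have ejj := e j j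
  have ekk := e k k
  simp [hD, hij, hij.symm, hik.symm, zik, zki, zjk, zkj] at eii eij eji ejj ekk
  have h4 : (4 : F) ≠ 0 := by
    rw [show (4 : F) = 2 * 2 by norm_num]
    exact mul_ne_zero h2 h2
  have hmain : M i i = 1 ∧ M j j = 1 ∧ M k k = 1 ∧ M i j * M j i = 0 := by
    by_cases h : M i i = M j j
    · have hk1 : M k k = 1 := by
        rw [← h] at hd
        linear_combination hd - M k k * eii
      have hi1 : M i i = 1 := by
        have : 2 * (M i i - 1) = 0 := by linear_combination htr - hk1 + h
        exact sub_eq_zero.1 ((mul_eq_zero.1 this).resolve_left h2)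
      exact ⟨hi1, h ▸ hi1, hk1, by linear_combination (M i i + 1) * hi1 - eii⟩
    · exfalso
      have h' := sub_ne_zero.2 h
      have bi : M i j = 0 := (mul_eq_zero.1 (by linear_combination eij)).resolve_left h'
      rw [bi] at eii ejj hd
      have hs : M i i + M j j = 0 :=
        (mul_eq_zero.1 (by linear_combination eii + ejj)).resolve_left h'
      apply h4
      have hk1 : M k k = -1 := by
        linear_combination M i i * M k k * hs - hd  - M k k * eii
      linear_combination hs  + hk1 - htr
  obtain ⟨ii, jj, kk, hb⟩ := hmain
  have cover : ∀ r : Fin 3, r = i ∨ r = j ∨ r = k := by lia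
  rcases mul_eq_zero.1 hb with hb | hb
  · right
    refine ⟨M j i, ?_⟩
    ext r s
    rcases cover r with rfl | rfl | rfl <;> rcases cover s with rfl | rfl | rfl <;>
      simp [transvection, *, Ne.symm]
  · left
    refine ⟨M i j, ?_⟩
    ext r s
    rcases cover r with rfl | rfl | rfl <;> rcases cover s with rfl | rfl | rfl <;>
      simp [transvection, *, Ne.symm]

section Homs

lemma hom_ext_of_transvection
    {φ ψ : SpecialLinearGroup (Fin 3) F →* Matrix (Fin 3) (Fin 3) F}
    (h : ∀ (i j : Fin 3) (hij : i ≠ j) (c : F), φ (SpecialLinearGroup.transvection hij c) =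
      ψ (SpecialLinearGroup.transvection hij c)) : φ = ψ := by
  ext1 x
  refine SpecialLinearGroup.diagonal_transvection_induction' (fun x ↦ φ x = ψ x) x ?_ h ?_
  · intro i j hij c hc
    simp only [diag2n_eq_prod_transvection hij hc, map_mul, h]
  · intro A B hA hB
    rw [map_mul, map_mul, hA, hB]

variable {φ : SpecialLinearGroup (Fin 3) F →* Matrix (Fin 3) (Fin 3) F}

lemma map_transvection_mul {i j k : Fin 3} (hij : i ≠ j) (hik : i ≠ k) (hjk : j ≠ k) (c d : F) :
    φ (SpecialLinearGroup.transvection hij c) * φ (SpecialLinearGroup.transvection hjk d) =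
      φ (SpecialLinearGroup.transvection hik (c * d)) *
        (φ (SpecialLinearGroup.transvection hjk d) *
          φ (SpecialLinearGroup.transvection hij c)) := by
  simp only [← map_mul]
  congr 1
  exact SpecialLinearGroup.coeMonoidHom_injective
    (transvection_mul_transvection_of_ne hik hjk c d)

lemma map_transvection_add {i j : Fin 3} (hij : i ≠ j) (c d : F) :
    φ (SpecialLinearGroup.transvection hij (c + d)) =
      φ (SpecialLinearGroup.transvection hij c) * φ (SpecialLinearGroup.transvection hij d) := by
  rw [← map_mul]
  congr 1
  exact SpecialLinearGroup.coeMonoidHom_injective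
    (transvection_mul_transvection_same i j hij c d).symm

/-- An injective homomorphism fixing the diagonal involutions sends each root subgroup to itself or
to the opposite root subgroup. -/
lemma map_transvection_eq_or (h2 : (2 : F) ≠ 0) {p : ℕ} [Fact p.Prime] [CharP F p]
    (hdet : ∀ x, (φ x).det = 1) (hφ : ∀ i, φ (diagInvolution i) = (diagInvolution i).1)
    {i j : Fin 3} (hij : i ≠ j) (c : F) :
    (∃ d, φ (SpecialLinearGroup.transvection hij c) = transvection i j d) ∨
      ∃ d, φ (SpecialLinearGroup.transvection hij c) = transvection j i d := by
  obtain ⟨k, hik, hjk⟩ : ∃ k, i ≠ k ∧ j ≠ k := by revert i j; decide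
  refine eq_transvection_or_eq_transvection h2 (p := p) hij hik hjk (hdet _) ?_
    (D := fun l ↦ (diagInvolution l).1) coe_diagInvolution ?_ ?_
  · rw [← map_pow, show SpecialLinearGroup.transvection hij c ^ p = 1 from ?_, map_one]
    apply SpecialLinearGroup.coeMonoidHom_injective
    rw [map_pow]
    exact (transvection_pow hij c p).trans (by simp)
  · simp only [← hφ, ← map_mul]
    congr 1
    apply SpecialLinearGroup.coeMonoidHom_injective
    ext r s
    simp [coe_diagInvolution, SpecialLinearGroup.transvection_coe, one_apply, single_apply]
    grind
  · simp only [← hφ, ← map_mul]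
    congr 1
    apply SpecialLinearGroup.coeMonoidHom_injective
    ext r s
    simp [coe_diagInvolution, SpecialLinearGroup.transvection_coe, mul_add, add_mul]
    simp [diagonal_apply, single_apply]
    grind

lemma eq_zero_of_map_transvection (hinj : Function.Injective φ) {i j : Fin 3} (hij : i ≠ j)
    {c : F} (h : φ (SpecialLinearGroup.transvection hij c) = 1) : c = 0 := by
  have h1 := hinj (h.trans (map_one φ).symm)
  simpa [SpecialLinearGroup.transvection_coe, hij] using
    congrArg (fun x : SpecialLinearGroup (Fin 3) F ↦ x.1 i j) h1

/-- The alternatives of `map_transvection_eq_or` agree on root subgroups in the same row. -/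
lemma map_transvection_row (hinj : Function.Injective φ)
    (hor : ∀ (i j : Fin 3) (hij : i ≠ j) (c : F),
      (∃ d, φ (SpecialLinearGroup.transvection hij c) = transvection i j d) ∨
        ∃ d, φ (SpecialLinearGroup.transvection hij c) = transvection j i d)
    {i j k : Fin 3} (hij : i ≠ j) (hik : i ≠ k) (hjk : j ≠ k)
    {b : F} (hb : b ≠ 0)
    (h : ∃ d, φ (SpecialLinearGroup.transvection hij b) = transvection i j d) (c : F) :
    ∃ d, φ (SpecialLinearGroup.transvection hik c) = transvection i k d := by
  refine (hor i k hik c).elim id fun ⟨e, he⟩ ↦ ?_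
  obtain ⟨d, hd⟩ := h
  have hcomm : φ (SpecialLinearGroup.transvection hik c) *
      φ (SpecialLinearGroup.transvection hij b) =
      φ (SpecialLinearGroup.transvection hij b) * φ (SpecialLinearGroup.transvection hik c) := by
    simp only [← map_mul]
    exact congrArg φ (SpecialLinearGroup.coeMonoidHom_injective
      (commute_transvection_same_row hik hij c b))
  rw [he, hd] at hcomm
  rcases mul_eq_zero.1 (eq_zero_of_commute_transvection hik.symm hjk.symm hij hcomm) with h0 | h0
  · exact ⟨0, by rw [he, h0, transvection_zero, transvection_zero]⟩
  · rw [h0, transvection_zero] at hd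
    exact absurd (eq_zero_of_map_transvection hinj hij hd) hb

/-- The alternatives of `map_transvection_eq_or` agree on root subgroups in the same column. -/
lemma map_transvection_col (hinj : Function.Injective φ)
    (hor : ∀ (i j : Fin 3) (hij : i ≠ j) (c : F),
      (∃ d, φ (SpecialLinearGroup.transvection hij c) = transvection i j d) ∨
        ∃ d, φ (SpecialLinearGroup.transvection hij c) = transvection j i d)
    {i j k : Fin 3} (hij : i ≠ j) (hik : i ≠ k) (hkj : k ≠ j)
    {b : F} (hb : b ≠ 0)
    (h : ∃ d, φ (SpecialLinearGroup.transvection hij b) = transvection i j d) (c : F) :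
    ∃ d, φ (SpecialLinearGroup.transvection hkj c) = transvection k j d := by
  refine (hor k j hkj c).elim id fun ⟨e, he⟩ ↦ ?_
  obtain ⟨d, hd⟩ := h
  have hcomm : φ (SpecialLinearGroup.transvection hij b) *
      φ (SpecialLinearGroup.transvection hkj c) =
      φ (SpecialLinearGroup.transvection hkj c) * φ (SpecialLinearGroup.transvection hij b) := by
    simp only [← map_mul]
    exact congrArg φ (SpecialLinearGroup.coeMonoidHom_injective
      (commute_transvection_same_col hij hkj.symm b c))
  rw [he, hd] at hcomm
  rcases mul_eq_zero.1 (eq_zero_of_commute_transvection hij hik hkj.symm hcomm) with h0 | h0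
  · rw [h0, transvection_zero] at hd
    exact absurd (eq_zero_of_map_transvection hinj hij hd) hb
  · exact ⟨0, by rw [he, h0, transvection_zero, transvection_zero]⟩

/-- A property of roots that is passed along rows and along columns holds for all roots. -/
lemma forall_root_of_row_of_col {P : ∀ i j : Fin 3, i ≠ j → Prop} (h01 : P 0 1 (by decide))
    (hrow : ∀ {i j k : Fin 3} (hij : i ≠ j) (hik : i ≠ k) (_ : j ≠ k), P i j hij → P i k hik)
    (hcol : ∀ {i j k : Fin 3} (hij : i ≠ j) (_ : i ≠ k) (hkj : k ≠ j), P i j hij → P k j hkj)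
    (i j : Fin 3) (hij : i ≠ j) : P i j hij := by
  have h02 : P 0 2 (by decide) := hrow _ _ (by decide) h01
  have h12 : P 1 2 (by decide) := hcol _ (by decide) _ h02
  have h10 : P 1 0 (by decide) := hrow _ _ (by decide) h12
  have h20 : P 2 0 (by decide) := hcol _ (by decide) _ h10
  have h21 : P 2 1 (by decide) := hrow _ _ (by decide) h20
  fin_cases i <;> fin_cases j <;> first | exact absurd rfl hij | assumption

/-- An injective homomorphism preserving every root subgroup is, up to a diagonal conjugation,
a field automorphism. -/
lemma exists_ringEquiv_of_map_transvection [Finite F] (hinj : Function.Injective φ)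
    (h : ∀ (i j : Fin 3) (hij : i ≠ j) (c : F),
      ∃ d, φ (SpecialLinearGroup.transvection hij c) = transvection i j d) :
    ∃ (σ : F ≃+* F) (D : GL (Fin 3) F), ∀ x : SpecialLinearGroup (Fin 3) F,
      D.1 * φ x = x.1.map σ * D.1 := by
  choose f hf using h
  have hmul : ∀ {i j k : Fin 3} (hij : i ≠ j) (hik : i ≠ k) (hjk : j ≠ k) (c d : F),
      f i k hik (c * d) = f i j hij c * f j k hjk d := by
    intro i j k hij hik hjk c d
    have h1 := congrFun₂ (map_transvection_mul (φ := φ) hij hik hjk c d) i k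
    simp only [hf] at h1
    simpa [transvection, mul_add, add_mul, hij, hik, hjk, hij.symm, hik.symm, hjk.symm]
      using h1.symm
  have hadd : ∀ (i j : Fin 3) (hij : i ≠ j) (c d : F),
      f i j hij (c + d) = f i j hij c + f i j hij d := by
    intro i j hij c d
    have h1 := congrFun₂ (map_transvection_add (φ := φ) hij c d) i j
    simp only [hf, transvection_mul_transvection_same i j hij] at h1
    simpa [transvection, hij] using h1
  have hzero : ∀ (i j : Fin 3) (hij : i ≠ j) (c : F), f i j hij c = 0 → c = 0 := by
    intro i j hij c hc
    apply eq_zero_of_map_transvection hinj hij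
    rw [hf, hc, transvection_zero]
  have hne : ∀ (i j : Fin 3) (hij : i ≠ j), f i j hij 1 ≠ 0 :=
    fun i j hij hc ↦ one_ne_zero (hzero i j hij 1 hc)
  have hcross : ∀ (i j : Fin 3) (hij : i ≠ j) (c : F),
      f i j hij c / f i j hij 1 = f 0 1 (by decide) c / f 0 1 (by decide) 1 := by
    refine forall_root_of_row_of_col (fun _ ↦ rfl) ?_ ?_
    · intro i j k hij hik hjk hP c
      rw [← hP, div_eq_div_iff (hne _ _ _) (hne _ _ _)]
      have e1 := hmul hij hik hjk c 1
      have e2 := hmul hij hik hjk 1 1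
      rw [mul_one] at e1 e2
      rw [e1, e2]
      ring
    · intro i j k hij hik hkj hP c
      rw [← hP, div_eq_div_iff (hne _ _ _) (hne _ _ _)]
      have e1 := hmul hik hij hkj 1 c
      have e2 := hmul hik hij hkj 1 1
      rw [one_mul] at e1 e2
      rw [e1, e2]
      ring
  set s : F → F := fun c ↦ f 0 1 (by decide) c / f 0 1 (by decide) 1 with hs
  have hfs : ∀ (i j : Fin 3) (hij : i ≠ j) (c : F), f i j hij c = f i j hij 1 * s c := by
    intro i j hij c
    rw [(div_eq_iff (hne i j hij)).1 (hcross i j hij c), mul_comm]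
  have s_add : ∀ c d, s (c + d) = s c + s d := fun c d ↦ by
    simp only [hs, hadd, add_div]
  have s_one : s 1 = 1 := div_self (hne _ _ _)
  have s_mul : ∀ c d, s (c * d) = s c * s d := by
    intro c d
    have e1 := hmul (i := 0) (j := 1) (k := 2) (by decide) (by decide) (by decide) c d
    have e2 := hmul (i := 0) (j := 1) (k := 2) (by decide) (by decide) (by decide) 1 1
    rw [hfs, hfs _ _ _ c, hfs _ _ _ d] at e1
    rw [one_mul] at e2
    rw [e2] at e1
    apply mul_left_cancel₀ (mul_ne_zero (hne 0 1 (by decide)) (hne 1 2 (by decide)))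
    rw [e1]
    ring
  let σ₀ : F →+* F := RingHom.mk' ⟨⟨s, s_one⟩, s_mul⟩ s_add
  let σ : F ≃+* F := RingEquiv.ofBijective σ₀ (Finite.injective_iff_bijective.1 σ₀.injective)
  have hσ : ∀ c, σ c = s c := fun _ ↦ rfl
  let d : Fin 3 → F := ![1, f 0 1 (by decide) 1, f 0 2 (by decide) 1]
  have hd : ∀ (i j : Fin 3) (hij : i ≠ j), d i * f i j hij 1 = d j := by
    have e : ∀ {i j k : Fin 3} (hij : i ≠ j) (hik : i ≠ k) (hjk : j ≠ k),
        f i k hik 1 = f i j hij 1 * f j k hjk 1 := fun hij hik hjk ↦ by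
      simpa using hmul hij hik hjk 1 1
    have d01 : d 0 * f 0 1 (by decide) 1 = d 1 := one_mul _
    have d02 : d 0 * f 0 2 (by decide) 1 = d 2 := one_mul _
    have d12 : d 1 * f 1 2 (by decide) 1 = d 2 := (e (by decide) _ _).symm
    have d21 : d 2 * f 2 1 (by decide) 1 = d 1 := (e (by decide) _ _).symm
    have d10 : d 1 * f 1 0 (by decide) 1 = d 0 := by
      apply mul_right_cancel₀ (hne 0 2 (by decide))
      rw [mul_assoc, ← e (by decide) (by decide) (by decide), d12, d02]
    have d20 : d 2 * f 2 0 (by decide) 1 = d 0 := by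
      apply mul_right_cancel₀ (hne 0 1 (by decide))
      rw [mul_assoc, ← e (by decide) (by decide) (by decide), d21, d01]
    intro i j hij
    fin_cases i <;> fin_cases j <;> first | exact absurd rfl hij | assumption
  have hd0 : ∀ i, d i ≠ 0 := by
    intro i
    fin_cases i
    exacts [one_ne_zero, hne _ _ _, hne _ _ _]
  let D : GL (Fin 3) F := GeneralLinearGroup.mkOfDetNeZero (diagonal d) (by
    rw [det_diagonal]
    exact Finset.prod_ne_zero_iff.2 fun i _ ↦ hd0 i)
  have hD : D.1 = diagonal d := rfl
  let ψ : SpecialLinearGroup (Fin 3) F →* Matrix (Fin 3) (Fin 3) F :=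
    { toFun := fun x ↦ D.1 * φ x * (D⁻¹).1
      map_one' := by simp
      map_mul' := fun x y ↦ by
        rw [map_mul]
        simp only [mul_assoc, Units.inv_mul_cancel_left] }
  let χ : SpecialLinearGroup (Fin 3) F →* Matrix (Fin 3) (Fin 3) F :=
    SpecialLinearGroup.coeMonoidHom.comp (SpecialLinearGroup.map σ.toRingHom)
  refine ⟨σ, D, fun x ↦ ?_⟩
  suffices hψχ : ψ = χ by
    have h1 : D.1 * φ x * (D⁻¹).1 = x.1.map σ := DFunLike.congr_fun hψχ x
    rw [← h1, Units.inv_mul_cancel_right]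
  refine hom_ext_of_transvection fun i j hij c ↦ ?_
  change D.1 * φ _ * (D⁻¹).1 = (transvection i j c).map σ
  rw [Units.mul_inv_eq_iff_eq_mul, hf, hfs, ← hσ, hD]
  ext r t
  rw [diagonal_mul, mul_diagonal, map_apply]
  simp only [transvection, Matrix.add_apply, single_apply, one_apply, map_add]
  split_ifs with h1 h2 h3
  · exact absurd (h2.1.trans (h1.trans h2.2.symm)) hij
  · simp [h1]
  · obtain ⟨rfl, rfl⟩ := h3
    rw [map_zero, zero_add, zero_add, ← mul_assoc, hd, mul_comm]
  · simp

/-- The inverse-transpose automorphism. -/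
def inverseTranspose : SpecialLinearGroup (Fin 3) F →* SpecialLinearGroup (Fin 3) F where
  toFun x := x⁻¹.transpose
  map_one' := by
    apply SpecialLinearGroup.coeMonoidHom_injective
    simp
  map_mul' x y := by
    apply SpecialLinearGroup.coeMonoidHom_injective
    rw [_root_.mul_inv_rev]
    simp [SpecialLinearGroup.coe_transpose]

lemma inverseTranspose_apply (x : SpecialLinearGroup (Fin 3) F) :
    inverseTranspose x = x⁻¹.transpose := rfl

lemma inverseTranspose_inverseTranspose (x : SpecialLinearGroup (Fin 3) F) :
    inverseTranspose (inverseTranspose x) = x := by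
  have h : (inverseTranspose x)⁻¹ = x.transpose := by
    rw [← map_inv, inverseTranspose_apply, inv_inv]
  rw [inverseTranspose_apply, h]
  exact Subtype.ext (transpose_transpose x.1)

lemma coe_inverseTranspose (x : SpecialLinearGroup (Fin 3) F) :
    (inverseTranspose x).1 = (x.1ᵀ)⁻¹ := by
  refine (inv_eq_right_inv ?_).symm
  have h := congrArg Subtype.val (inv_mul_cancel x)
  exact (transpose_mul (x⁻¹).1 x.1).symm.trans ((congrArg Matrix.transpose h).trans transpose_one)

lemma inverseTranspose_diagInvolution (i : Fin 3) :
    inverseTranspose (diagInvolution i : SpecialLinearGroup (Fin 3) F) = diagInvolution i := by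
  rw [inverseTranspose_apply, inv_eq_of_mul_eq_one_left (diagInvolution_mul_self i)]
  exact Subtype.ext (diagonal_transpose _)

lemma inverseTranspose_transvection {i j : Fin 3} (hij : i ≠ j) (c : F) :
    inverseTranspose (SpecialLinearGroup.transvection hij c) =
      SpecialLinearGroup.transvection hij.symm (-c) := by
  rw [inverseTranspose_apply, SpecialLinearGroup.transvection_inv hij]
  apply SpecialLinearGroup.coeMonoidHom_injective
  exact show (1 + single i j (-c))ᵀ = 1 + single j i (-c) by simp

/-- An injective homomorphism fixing the diagonal involutions, composed with the inverse-transpose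
automorphism if necessary, is a field automorphism up to conjugation. -/
lemma exists_ringEquiv_of_map_diagInvolution [Finite F] (h2 : (2 : F) ≠ 0) {p : ℕ} [Fact p.Prime]
    [CharP F p] (hinj : Function.Injective φ) (hdet : ∀ x, (φ x).det = 1)
    (hφ : ∀ i, φ (diagInvolution i) = (diagInvolution i).1) :
    ∃ (σ : F ≃+* F) (D : GL (Fin 3) F) (ε : Bool), ∀ x : SpecialLinearGroup (Fin 3) F,
      D.1 * φ x = (if ε then (x.1ᵀ)⁻¹ else x.1).map σ * D.1 := by
  have main : ∀ ψ : SpecialLinearGroup (Fin 3) F →* Matrix (Fin 3) (Fin 3) F,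
      Function.Injective ψ → (∀ x, (ψ x).det = 1) →
      (∀ i, ψ (diagInvolution i) = (diagInvolution i).1) →
      (∀ c, ∃ d, ψ (SpecialLinearGroup.transvection zero_ne_one c) = transvection 0 1 d) →
      ∃ (σ : F ≃+* F) (D : GL (Fin 3) F), ∀ x : SpecialLinearGroup (Fin 3) F,
        D.1 * ψ x = x.1.map σ * D.1 := by
    intro ψ hinj hdet hψ h
    have hor := fun i j hij c ↦ map_transvection_eq_or (i := i) (j := j) h2 (p := p) hdet hψ hij c
    exact exists_ringEquiv_of_map_transvection hinj (forall_root_of_row_of_col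
      (P := fun i j hij ↦ ∀ c, ∃ d,
        ψ (SpecialLinearGroup.transvection hij c) = transvection i j d) h
      (fun hij hik hjk hP ↦ map_transvection_row hinj hor hij hik hjk one_ne_zero (hP 1))
      (fun hij hik hkj hP ↦ map_transvection_col hinj hor hij hik hkj one_ne_zero (hP 1)))
  rcases map_transvection_eq_or (p := p) h2 hdet hφ (zero_ne_one (α := Fin 3)) 1 with h | hd
  · have hor := fun i j hij c ↦ map_transvection_eq_or (i := i) (j := j) h2 (p := p) hdet hφ hij c
    have h02 := map_transvection_row hinj hor zero_ne_one (k := 2) (by decide) (by decide)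
      one_ne_zero h 1
    have h01 := map_transvection_row hinj hor _ zero_ne_one (by decide) one_ne_zero h02
    obtain ⟨σ, D, h⟩ := main φ hinj hdet hφ h01
    exact ⟨σ, D, false, by simpa using h⟩
  · set ψ := φ.comp inverseTranspose with hψdef
    have hψinj : Function.Injective ψ :=
      hinj.comp (Function.LeftInverse.injective inverseTranspose_inverseTranspose)
    have hψdet : ∀ x, (ψ x).det = 1 := fun _ ↦ hdet _
    have hψ : ∀ i, ψ (diagInvolution i) = (diagInvolution i).1 := fun i ↦ by
      rw [hψdef, MonoidHom.comp_apply, inverseTranspose_diagInvolution, hφ]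
    have hor := fun i j hij c ↦
      map_transvection_eq_or (i := i) (j := j) h2 (p := p) hψdet hψ hij c
    have h10 : ∃ d, ψ (SpecialLinearGroup.transvection one_ne_zero (-1)) =
        transvection 1 0 d := by
      rwa [hψdef, MonoidHom.comp_apply, inverseTranspose_transvection, neg_neg]
    have h12 := map_transvection_row hψinj hor one_ne_zero (k := 2) (by decide) (by decide)
      (neg_ne_zero.2 one_ne_zero) h10 1
    have h02 := map_transvection_col hψinj hor _ one_ne_zero (by decide) one_ne_zero h12 1
    have h01 := map_transvection_row hψinj hor _ zero_ne_one (by decide) one_ne_zero h02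
    obtain ⟨σ, D, h⟩ := main ψ hψinj hψdet hψ h01
    refine ⟨σ, D, true, fun x ↦ ?_⟩
    have hx := h (inverseTranspose x)
    rw [hψdef, MonoidHom.comp_apply, inverseTranspose_inverseTranspose,
      coe_inverseTranspose] at hx
    simpa using hx

end Homs

end SL3Aut

/-- Automorphisms of `SL₃(F)` for a finite field `F` of odd order: every group
automorphism `δ` of `SL₃(F)` is a product of a conjugation by a matrix `g ∈ GL₃(F)`,
possibly the inverse-transpose automorphism `τ : x ↦ (xᵀ)⁻¹` (according to `ε`), and a
field automorphism `σ` applied entrywise: `δ x = g⁻¹ * σ(τᵉ x) * g` for all `x`. -/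
theorem sl3_automorphism_description {F : Type*} [Field F] [Fintype F]
    (hodd : Odd (Fintype.card F))
    (δ : Matrix.SpecialLinearGroup (Fin 3) F ≃* Matrix.SpecialLinearGroup (Fin 3) F) :
    ∃ (g : GL (Fin 3) F) (σ : F ≃+* F) (ε : Bool),
      ∀ x : Matrix.SpecialLinearGroup (Fin 3) F,
        (δ x : Matrix (Fin 3) (Fin 3) F) =
          ((g⁻¹ : GL (Fin 3) F) : Matrix (Fin 3) (Fin 3) F) *
            ((if ε then ((x : Matrix (Fin 3) (Fin 3) F)ᵀ)⁻¹
              else (x : Matrix (Fin 3) (Fin 3) F)).map σ) *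
            ((g : GL (Fin 3) F) : Matrix (Fin 3) (Fin 3) F) := by
  obtain ⟨p, hchar⟩ := CharP.exists F
  have : Fact p.Prime := ⟨CharP.char_is_prime F p⟩
  have h2 : (2 : F) ≠ 0 := Ring.two_ne_zero fun h ↦ by
    have := FiniteField.even_card_iff_char_two.1 h
    have := Nat.odd_iff.1 hodd
    lia
  have hmul : ∀ x y, (δ x).1 * (δ y).1 = (δ (x * y)).1 := fun x y ↦ by
    rw [map_mul]
    rfl
  have hone : (δ 1).1 = 1 := by
    rw [map_one]
    rfl
  have hne : ∀ x, x ≠ 1 → (δ x).1 ≠ 1 := fun x hx h ↦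
    hx (δ.injective (Subtype.ext (h.trans hone.symm)))
  have h01 : (SL3Aut.diagInvolution 0 * SL3Aut.diagInvolution 1 :
      Matrix.SpecialLinearGroup (Fin 3) F) = SL3Aut.diagInvolution 2 :=
    SL3Aut.diagInvolution_mul (by decide) (by decide) (by decide)
  have h10 : (SL3Aut.diagInvolution 1 * SL3Aut.diagInvolution 0 :
      Matrix.SpecialLinearGroup (Fin 3) F) = SL3Aut.diagInvolution 2 :=
    SL3Aut.diagInvolution_mul (by decide) (by decide) (by decide)
  obtain ⟨Q, hQ0, hQ1⟩ := SL3Aut.exists_conj_diagInvolution h2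
    (A := (δ (SL3Aut.diagInvolution 0)).1) (B := (δ (SL3Aut.diagInvolution 1)).1)
    (by rw [hmul, SL3Aut.diagInvolution_mul_self, hone])
    (by rw [hmul, SL3Aut.diagInvolution_mul_self, hone])
    (by rw [hmul, hmul, h01, h10]) (δ _).2 (δ _).2
    (hne _ (SL3Aut.diagInvolution_ne_one h2 0)) (hne _ (SL3Aut.diagInvolution_ne_one h2 1))
    (by rw [hmul, h01]; exact hne _ (SL3Aut.diagInvolution_ne_one h2 2))
  let φ : Matrix.SpecialLinearGroup (Fin 3) F →* Matrix (Fin 3) (Fin 3) F :=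
    { toFun := fun x ↦ (Q⁻¹).1 * (δ x).1 * Q.1
      map_one' := by rw [hone, mul_one, Units.inv_mul]
      map_mul' := fun x y ↦ by
        rw [← hmul]
        simp only [mul_assoc, Units.mul_inv_cancel_left] }
  have hφ : ∀ x, φ x = (Q⁻¹).1 * (δ x).1 * Q.1 := fun _ ↦ rfl
  have hφ_of : ∀ x, (δ x).1 * Q.1 = Q.1 * x.1 → φ x = x.1 := fun x hx ↦ by
    rw [hφ, mul_assoc, hx, Units.inv_mul_cancel_left]
  have hinj : Function.Injective φ := fun x y hxy ↦ by
    rw [hφ, hφ, Units.mul_left_inj, Units.mul_right_inj] at hxy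
    exact δ.injective (Subtype.ext hxy)
  have hdet : ∀ x, (φ x).det = 1 := fun x ↦ by
    have h := congrArg det (Units.inv_mul Q)
    rw [det_mul, det_one] at h
    rw [hφ, det_mul, det_mul, (δ x).2, mul_one, h]
  have hQ2 : φ (SL3Aut.diagInvolution 2) = (SL3Aut.diagInvolution 2).1 := by
    rw [← h01, map_mul, hφ_of _ hQ0, hφ_of _ hQ1]
    rfl
  obtain ⟨σ, D, ε, h⟩ := SL3Aut.exists_ringEquiv_of_map_diagInvolution h2 (p := p) hinj hdet
    fun i ↦ by
      fin_cases i
      exacts [hφ_of _ hQ0, hφ_of _ hQ1, hQ2]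
  refine ⟨D * Q⁻¹, σ, ε, fun x ↦ ?_⟩
  rw [Units.val_mul, ← mul_assoc, mul_assoc _ _ D.1, ← h x, hφ, _root_.mul_inv_rev, inv_inv,
    Units.val_mul]
  simp only [mul_assoc, Units.inv_mul_cancel_left, Units.mul_inv_cancel_left, Units.mul_inv,
    mul_one]
end

section
/- Let F be a finite field of odd order q. Every group automorphism of PGL₂(F) is a product of a conjugation by (the image in PGL₂(F) of) a matrix from GL₂(F) and a field automorphism: for every automorphism δ of PGL₂(F) there exist g ∈ GL₂(F) and a field automorphism σ of F such that for all x ∈ PGL₂(F), δ(x) = [g]⁻¹ · σ̄(x) · [g], where [g] is the image of g in PGL₂(F) and σ̄ is the automorphism of PGL₂(F) induced by applying σ entrywise to matrices. -/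
open Matrix

namespace PGL2

open ProjGenLinGroup
open scoped MatrixGroups

variable {F : Type*} [Field F]

/-- The upper unitriangular matrix `!![1, t; 0, 1]`. -/
def unip (t : F) : GL (Fin 2) F :=
  GeneralLinearGroup.mkOfDetNeZero !![1, t; 0, 1] (by simp)

/-- The diagonal matrix `!![a, 0; 0, 1]`. -/
def torus (a : Fˣ) : GL (Fin 2) F :=
  GeneralLinearGroup.mkOfDetNeZero !![(a : F), 0; 0, 1] (by simp)

/-- The Weyl element `!![0, 1; -1, 0]`. -/
def weyl : GL (Fin 2) F :=
  GeneralLinearGroup.mkOfDetNeZero !![0, 1; -1, 0] (by simp)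

@[simp] lemma val_unip (t : F) : (unip t).val = !![1, t; 0, 1] := rfl

@[simp] lemma val_torus (a : Fˣ) : (torus a).val = !![(a : F), 0; 0, 1] := rfl

@[simp] lemma val_weyl : (weyl : GL (Fin 2) F).val = !![0, 1; -1, 0] := rfl

lemma mk_eq_mk_iff_smul {A B : GL (Fin 2) F} :
    mk A = mk B ↔ ∃ c : F, c ≠ 0 ∧ A.val = c • B.val := by
  rw [eq_comm, mk_eq_mk_iff]
  constructor
  · rintro ⟨u, rfl⟩
    refine ⟨u, u.ne_zero, ?_⟩
    ext i j
    simp [mul_comm]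
  · rintro ⟨c, hc, h⟩
    refine ⟨Units.mk0 c hc, ?_⟩
    ext i j
    simp [h, mul_comm]

lemma mk_eq_mk_iff_entries {A B : GL (Fin 2) F} :
    mk A = mk B ↔ ∃ c : F, c ≠ 0 ∧
      A.val 0 0 = c * B.val 0 0 ∧ A.val 0 1 = c * B.val 0 1 ∧
      A.val 1 0 = c * B.val 1 0 ∧ A.val 1 1 = c * B.val 1 1 := by
  rw [mk_eq_mk_iff_smul]
  simp only [← Matrix.ext_iff, Fin.forall_fin_two, Matrix.smul_apply, smul_eq_mul, and_assoc]

lemma det_entries_ne_zero (M : GL (Fin 2) F) :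
    M.val 0 0 * M.val 1 1 - M.val 0 1 * M.val 1 0 ≠ 0 := by
  rw [← Matrix.det_fin_two]
  exact M.det.ne_zero

lemma unip_add (s t : F) : unip (s + t) = unip s * unip t := by
  ext i j
  fin_cases i <;> fin_cases j <;> simp [add_comm]

lemma torus_mul (a b : Fˣ) : torus (a * b) = torus a * torus b := by
  ext i j
  fin_cases i <;> fin_cases j <;> simp

/-- The diagonal torus as a homomorphism to `PGL₂`. -/
def mkTorus : Fˣ →* PGL(2, F) :=
  mk.comp (MonoidHom.mk' torus torus_mul)

lemma mkTorus_apply (a : Fˣ) : mkTorus a = mk (torus a) := rfl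

lemma torus_mul_unip (a : Fˣ) (t : F) : torus a * unip t = unip (a * t) * torus a := by
  ext i j
  fin_cases i <;> fin_cases j <;> simp

lemma mk_unip_injective : Function.Injective fun t : F ↦ mk (unip t) := by
  intro s t h
  obtain ⟨c, -, h1, h2, -, -⟩ := mk_eq_mk_iff_entries.1 h
  obtain rfl : 1 = c := by simpa using h1
  simpa using h2

lemma mk_torus_injective : Function.Injective fun a : Fˣ ↦ mk (torus a) := by
  intro s t h
  obtain ⟨c, -, h1, h2, -, h4⟩ := mk_eq_mk_iff_entries.1 h
  ext
  simp_all

lemma lower_left_eq_zero_of_mul_unip {M : GL (Fin 2) F} {s : F}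
    (h : mk M * mk (unip 1) = mk (unip s) * mk M) : M.val 1 0 = 0 := by
  rw [← map_mul, ← map_mul] at h
  obtain ⟨c, -, h1, h2, h3, h4⟩ := mk_eq_mk_iff_entries.1 h
  simp [Matrix.mul_apply] at h1 h2 h3 h4
  by_contra h0
  obtain rfl : c = 1 := by
    apply mul_right_cancel₀ h0
    rw [one_mul, ← h3]
  exact h0 (by linear_combination h4)

lemma exists_eq_unip_of_commute {x : PGL(2, F)}
    (h : Commute x (mk (unip 1))) : ∃ t : F, x = mk (unip t) := by
  obtain ⟨M, rfl⟩ := mk_surjective x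
  have h0 := lower_left_eq_zero_of_mul_unip h
  have hd := det_entries_ne_zero M
  have h' := h.eq
  rw [← map_mul, ← map_mul] at h'
  obtain ⟨c, -, h1, h2, h3, h4⟩ := mk_eq_mk_iff_entries.1 h'
  simp [Matrix.mul_apply, h0] at h1 h2 h3 h4
  have h11 : M.val 1 1 ≠ 0 := by
    rintro h
    simp [h, h0] at hd
  obtain rfl : c = 1 := by
    apply mul_right_cancel₀ h11
    rw [one_mul, ← h4]
  refine ⟨M.val 0 1 / M.val 1 1, mk_eq_mk_iff_entries.2 ⟨M.val 1 1, h11, ?_, ?_, ?_, ?_⟩⟩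
  · simp
    linear_combination h2
  · simp
    field_simp
  · simpa using h0
  · simp

lemma exists_map_unip_eq {δ : PGL(2, F) →* PGL(2, F)} (h : δ (mk (unip 1)) = mk (unip 1))
    (t : F) : ∃ s, δ (mk (unip t)) = mk (unip s) := by
  apply exists_eq_unip_of_commute
  rw [Commute, SemiconjBy, ← h, ← map_mul, ← map_mul, ← map_mul, ← map_mul, ← unip_add,
    ← unip_add, add_comm]

/-- An element of `PGL₂` with vanishing lower left entry is the product of a unipotent and a
diagonal one. -/
lemma exists_mk_eq_unip_mul_torus {M : GL (Fin 2) F} (h : M.val 1 0 = 0) :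
    ∃ (t : F) (a : Fˣ), mk M = mk (unip t) * mk (torus a) := by
  have hd := det_entries_ne_zero M
  rw [h, mul_zero, sub_zero] at hd
  have h0 := left_ne_zero_of_mul hd
  have h1 := right_ne_zero_of_mul hd
  refine ⟨M.val 0 1 / M.val 1 1, Units.mk0 _ (div_ne_zero h0 h1), ?_⟩
  rw [← map_mul]
  refine mk_eq_mk_iff_entries.2 ⟨M.val 1 1, h1, ?_, ?_, ?_, ?_⟩ <;>
    simp [h] <;> field_simp

/-- The unipotent elements, the diagonal torus and the Weyl element generate `PGL₂`. -/
lemma hom_ext {H : Type*} [Group H] {f g : PGL(2, F) →* H}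
    (hu : ∀ t, f (mk (unip t)) = g (mk (unip t)))
    (ht : ∀ a, f (mk (torus a)) = g (mk (torus a)))
    (hw : f (mk weyl) = g (mk weyl)) : f = g := by
  have upper {M : GL (Fin 2) F} (h : M.val 1 0 = 0) : f (mk M) = g (mk M) := by
    obtain ⟨t, a, h⟩ := exists_mk_eq_unip_mul_torus h
    simp [h, hu, ht]
  ext x
  obtain ⟨M, rfl⟩ := mk_surjective x
  by_cases h0 : M.val 1 0 = 0
  · exact upper h0
  obtain ⟨N, hN, hM⟩ : ∃ N : GL (Fin 2) F, N.val 1 0 = 0 ∧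
      M = unip (M.val 0 0 / M.val 1 0) * weyl * N := by
    refine ⟨weyl⁻¹ * (unip (M.val 0 0 / M.val 1 0))⁻¹ * M, ?_, by group⟩
    simp [Matrix.mul_apply, Matrix.inv_def, Matrix.adjugate_fin_two, Fin.sum_univ_two]
    field_simp
    ring
  rw [hM]
  simp only [map_mul, hu, hw, upper hN]

/-- An element of order the characteristic in `PGL₂` over a perfect field is conjugate to the
standard unipotent element. -/
lemma exists_conj_eq_unip_one (p : ℕ) [Fact p.Prime] [CharP F p] [PerfectRing F p]
    {x : PGL(2, F)} (hx : x ≠ 1) (hp : x ^ p = 1) :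
    ∃ P : GL (Fin 2) F, x * mk P = mk P * mk (unip 1) := by
  obtain ⟨A, rfl⟩ := mk_surjective x
  rw [← map_pow, ← map_one mk] at hp
  obtain ⟨c, hc, h⟩ := mk_eq_mk_iff_smul.1 hp
  obtain ⟨d, rfl⟩ := surjective_frobenius F p c
  rw [frobenius_def] at hc h
  have hd : d ≠ 0 := by
    rintro rfl
    simp [(Fact.out : p.Prime).ne_zero] at hc
  have hN : (A.val - d • (1 : Matrix (Fin 2) (Fin 2) F)) ^ p = 0 := by
    rw [sub_pow_expChar_of_commute p ((Commute.one_right _).smul_right d), smul_pow, one_pow]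
    simpa [sub_eq_zero] using h
  have htr := (Matrix.isNilpotent_trace_of_isNilpotent ⟨p, hN⟩).eq_zero
  have hdet : (A.val - d • (1 : Matrix (Fin 2) (Fin 2) F)).det = 0 := by
    have := congrArg Matrix.det hN
    rw [Matrix.det_pow, Matrix.det_zero] at this
    exact pow_eq_zero_iff (Fact.out : p.Prime).ne_zero |>.1 this
  rw [Matrix.trace_fin_two] at htr
  rw [Matrix.det_fin_two] at hdet
  simp at htr hdet
  by_cases h10 : A.val 1 0 = 0
  · have h00 : A.val 0 0 = d := by
      rw [h10, mul_zero, sub_zero, mul_eq_zero] at hdet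
      rcases hdet with h | h
      · linear_combination h
      · linear_combination htr - h
    have h11 : A.val 1 1 = d := by linear_combination htr - h00
    have h01 : A.val 0 1 ≠ 0 := by
      intro h01
      apply hx
      rw [← map_one mk]
      exact mk_eq_mk_iff_entries.2 ⟨d, hd, by simp [h00], by simp [h01], by simp [h10],
        by simp [h11]⟩
    refine ⟨GeneralLinearGroup.mkOfDetNeZero !![A.val 0 1 / d, 0; 0, 1] (by simp [h01, hd]), ?_⟩
    rw [← map_mul, ← map_mul]
    refine mk_eq_mk_iff_entries.2 ⟨d, hd, ?_, ?_, ?_, ?_⟩ <;>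
      simp [h10, h00, h11, Matrix.mul_apply]
    field_simp
  · refine ⟨GeneralLinearGroup.mkOfDetNeZero !![(A.val 0 0 - d) / d, 1; A.val 1 0 / d, 0]
      (by simp [h10, hd]), ?_⟩
    rw [← map_mul, ← map_mul]
    refine mk_eq_mk_iff_entries.2 ⟨d, hd, ?_, ?_, ?_, ?_⟩ <;>
      simp [Matrix.mul_apply] <;> field_simp
    · linear_combination (A.val 0 0 - d) * htr - hdet
    · ring
    · linear_combination htr

/-- An element of `PGL₂` outside the diagonal torus which inverts a nontrivial diagonal element
is antidiagonal. -/
lemma antidiagonal_of_torus_mul_mul_torus {M : GL (Fin 2) F} {a : Fˣ} (ha : a ≠ 1)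
    (h : mk (torus a) * mk M * mk (torus a) = mk M) (hM : ∀ b, mk M ≠ mk (torus b)) :
    M.val 0 0 = 0 ∧ M.val 1 1 = 0 := by
  have hd := det_entries_ne_zero M
  have ha0 := a.ne_zero
  have ha1 : (a : F) - 1 ≠ 0 := by
    rwa [sub_ne_zero, Ne, Units.val_eq_one]
  rw [← map_mul, ← map_mul] at h
  obtain ⟨c, -, h1, h2, h3, h4⟩ := mk_eq_mk_iff_entries.1 h
  simp [Matrix.mul_apply, Matrix.vecMul, dotProduct, -mul_eq_mul_right_iff] at h1 h2 h3 h4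
  have h11 : M.val 1 1 = 0 := by
    by_contra h0
    obtain rfl : c = 1 := by
      apply mul_right_cancel₀ h0
      rw [one_mul, ← h4]
    have h01 : M.val 0 1 = 0 := by
      apply (mul_eq_zero.1 (_ : ((a : F) - 1) * M.val 0 1 = 0)).resolve_left ha1
      linear_combination h2
    have h10 : M.val 1 0 = 0 := by
      apply (mul_eq_zero.1 (_ : ((a : F) - 1) * M.val 1 0 = 0)).resolve_left ha1
      linear_combination h3
    have h00 : M.val 0 0 ≠ 0 := by
      intro h
      simp [h, h01] at hd
    refine hM (Units.mk0 _ (div_ne_zero h00 h0)) ?_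
    refine mk_eq_mk_iff_entries.2 ⟨M.val 1 1, h0, ?_, ?_, ?_, ?_⟩ <;> simp [h01, h10]
    field_simp
  refine ⟨?_, h11⟩
  have h01 : M.val 0 1 ≠ 0 := by
    intro h
    simp [h, h11] at hd
  obtain rfl : (a : F) = c := mul_right_cancel₀ h01 h2
  have : ((a : F) * (a - 1)) * M.val 0 0 = 0 := by linear_combination h1
  exact (mul_eq_zero.1 this).resolve_left (mul_ne_zero ha0 ha1)

lemma torus_weyl_torus (a : Fˣ) :
    mk (torus a) * mk weyl * mk (torus a) = mk weyl := by
  rw [← map_mul, ← map_mul]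
  refine mk_eq_mk_iff_entries.2 ⟨a, a.ne_zero, ?_, ?_, ?_, ?_⟩ <;> simp [Matrix.mul_apply]

lemma weyl_mul_unip_pow_three : (mk weyl * mk (unip 1) : PGL(2, F)) ^ 3 = 1 := by
  rw [← map_mul, ← map_pow, ← map_one mk]
  refine mk_eq_mk_iff_entries.2 ⟨1, one_ne_zero, ?_, ?_, ?_, ?_⟩ <;>
    simp [Matrix.mul_apply, pow_succ]

/-- An antidiagonal element `w` of `PGL₂` with `(w * u) ^ 3 = 1`, for `u` the standard unipotent
element, is the Weyl element. -/
lemma mk_eq_weyl_of_antidiagonal {M : GL (Fin 2) F} (h00 : M.val 0 0 = 0) (h11 : M.val 1 1 = 0)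
    (h : (mk M * mk (unip 1)) ^ 3 = 1) : mk M = mk weyl := by
  have hd := det_entries_ne_zero M
  rw [h00, zero_mul, zero_sub, neg_ne_zero] at hd
  have h01 := left_ne_zero_of_mul hd
  have h10 := right_ne_zero_of_mul hd
  rw [← map_mul, ← map_pow, ← map_one mk] at h
  obtain ⟨c, -, h1, h2, h3, h4⟩ := mk_eq_mk_iff_entries.1 h
  simp [Matrix.mul_apply, pow_succ, Fin.sum_univ_two, h00, h11] at h1 h2 h3 h4
  have key : M.val 1 0 = - M.val 0 1 := by
    grind
  refine mk_eq_mk_iff_entries.2 ⟨M.val 0 1, h01, ?_, ?_, ?_, ?_⟩ <;> simp [h00, h11, key]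

/-- An injective endomorphism of `PGL₂` fixing the standard unipotent element and preserving the
diagonal torus is induced by a field automorphism. -/
lemma exists_eq_map [Finite F] {δ : PGL(2, F) →* PGL(2, F)} (hδ : Function.Injective δ)
    (h1 : δ (mk (unip 1)) = mk (unip 1)) (ht : ∀ a, ∃ b, δ (mk (torus a)) = mk (torus b))
    (hF : ∃ a : Fˣ, a ≠ 1) : ∃ σ : F ≃+* F, δ = ProjGenLinGroup.map σ.toRingHom := by
  choose φ hφ using ht
  choose ψ hψ using exists_map_unip_eq h1
  have ψ_one : ψ 1 = 1 := by
    apply mk_unip_injective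
    simp only [← hψ, h1]
  have ψ_add (s t : F) : ψ (s + t) = ψ s + ψ t := by
    apply mk_unip_injective
    simp only [← hψ, unip_add, map_mul]
  have ψ_zero : ψ 0 = 0 := by
    have := ψ_add 0 0
    simpa using this
  have ψ_unit (a : Fˣ) (t : F) : ψ (a * t) = φ a * ψ t := by
    apply mk_unip_injective
    have h := congrArg (fun x ↦ δ (mk x)) (torus_mul_unip a t)
    simp only [map_mul, hψ, hφ] at h
    rw [← map_mul, torus_mul_unip, map_mul] at h
    exact (mul_right_cancel h).symm
  have φ_eq (a : Fˣ) : (φ a : F) = ψ a := by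
    simpa [ψ_one] using (ψ_unit a 1).symm
  have ψ_mul (s t : F) : ψ (s * t) = ψ s * ψ t := by
    by_cases hs : s = 0
    · simp [hs, ψ_zero]
    · simpa [φ_eq] using ψ_unit (Units.mk0 s hs) t
  let f : F →+* F :=
    { toFun := ψ, map_one' := ψ_one, map_mul' := ψ_mul, map_zero' := ψ_zero, map_add' := ψ_add }
  let σ : F ≃+* F := RingEquiv.ofBijective f (Finite.injective_iff_bijective.1 f.injective)
  have hσ (t : F) : σ t = ψ t := rfl
  refine ⟨σ, hom_ext (fun t ↦ ?_) (fun a ↦ ?_) ?_⟩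
  · rw [hψ, map_mk]
    congr 1
    ext i j
    fin_cases i <;> fin_cases j <;> simp [hσ, ψ_one, ψ_zero]
  · rw [hφ, map_mk]
    congr 1
    ext i j
    fin_cases i <;> fin_cases j <;> simp [hσ, φ_eq, ψ_one, ψ_zero]
  · have hmap : ProjGenLinGroup.map σ.toRingHom (mk weyl) = mk weyl := by
      rw [map_mk]
      congr 1
      ext i j
      fin_cases i <;> fin_cases j <;> simp
    rw [hmap]
    obtain ⟨M, hM⟩ := mk_surjective (δ (mk weyl))
    obtain ⟨a, ha⟩ := hF
    have hφa : φ a ≠ 1 := by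
      intro h
      apply ha
      rw [← Units.val_eq_one, φ_eq, ← hσ, map_eq_one_iff _ σ.injective] at h
      exact Units.val_eq_one.1 h
    have hanti := antidiagonal_of_torus_mul_mul_torus (M := M) hφa
      (by rw [hM, ← hφ, ← map_mul, ← map_mul, torus_weyl_torus]) (by
        intro b hb
        let b' : Fˣ := Units.mk0 (σ.symm b) (by simp)
        have hb' : φ b' = b := by
          ext
          simp [φ_eq, ← hσ, b']
        rw [hM, ← hb', ← hφ] at hb
        obtain ⟨c, hc, -, h, -, -⟩ := mk_eq_mk_iff_entries.1 (hδ hb)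
        simp at h)
    rw [← hM]
    apply mk_eq_weyl_of_antidiagonal hanti.1 hanti.2
    rw [hM, ← h1, ← map_mul, ← map_pow, weyl_mul_unip_pow_three, map_one]

/-- A diagonalisable upper triangular element of `PGL₂` is conjugate by a unipotent element to a
diagonal one. -/
lemma exists_unip_conj_torus (t : F) {b : Fˣ} (hb : b ≠ 1) :
    ∃ r : F, unip t * torus b * unip r = unip r * torus b := by
  have hb1 : 1 - (b : F) ≠ 0 := by
    rw [sub_ne_zero]
    exact fun h ↦ hb (Units.val_eq_one.1 h.symm)
  refine ⟨t / (1 - b), ?_⟩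
  ext i j
  fin_cases i <;> fin_cases j <;> simp
  field_simp
  ring

/-- An injective endomorphism of `PGL₂` over a finite field with more than two elements is the
composition of a field automorphism and an inner automorphism. -/
theorem exists_conj_map [Finite F] {δ : PGL(2, F) →* PGL(2, F)} (hδ : Function.Injective δ)
    (hF : ∃ a : Fˣ, a ≠ 1) :
    ∃ (g : GL (Fin 2) F) (σ : F ≃+* F), ∀ x,
      δ x = (mk g)⁻¹ * ProjGenLinGroup.map σ.toRingHom x * mk g := by
  obtain ⟨p, hp⟩ := CharP.exists F
  have : Fact p.Prime := ⟨CharP.char_is_prime F p⟩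
  have u_pow : (mk (unip 1) : PGL(2, F)) ^ p = 1 := by
    have (n : ℕ) : (unip 1 : GL (Fin 2) F) ^ n = unip (n : F) := by
      induction n with
      | zero => ext i j; fin_cases i <;> fin_cases j <;> simp
      | succ n ih => rw [pow_succ, ih, ← unip_add, Nat.cast_succ]
    rw [← map_pow, this, CharP.cast_eq_zero, ← map_one mk]
    congr 1
    ext i j
    fin_cases i <;> fin_cases j <;> simp
  have unip_zero : (mk (unip 0) : PGL(2, F)) = 1 := by
    rw [← map_one mk]
    congr 1
    ext i j
    fin_cases i <;> fin_cases j <;> simp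
  have u_ne : (mk (unip 1) : PGL(2, F)) ≠ 1 := by
    rw [← unip_zero]
    exact fun h ↦ one_ne_zero (mk_unip_injective h)
  obtain ⟨P, hP⟩ := exists_conj_eq_unip_one p (x := δ (mk (unip 1)))
    (by rwa [Ne, map_eq_one_iff δ hδ]) (by rw [← map_pow, u_pow, map_one])
  -- After conjugating by `P`, the standard unipotent element is fixed.
  let ε : PGL(2, F) →* PGL(2, F) := (MulAut.conj (mk P)⁻¹).toMonoidHom.comp δ
  have hε (x) : ε x = (mk P)⁻¹ * δ x * mk P := by simp [ε]
  have ε_inj : Function.Injective ε := (MulAut.conj (mk P)⁻¹).injective.comp hδ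
  have ε_u : ε (mk (unip 1)) = mk (unip 1) := by
    rw [hε, mul_assoc, hP, inv_mul_cancel_left]
  obtain ⟨a, ha⟩ := IsCyclic.exists_generator (α := Fˣ)
  have ha1 : a ≠ 1 := by
    rintro rfl
    obtain ⟨b, hb⟩ := hF
    exact hb (by simpa using ha b)
  obtain ⟨M, hM⟩ := mk_surjective (ε (mk (torus a)))
  have hM0 : M.val 1 0 = 0 := by
    obtain ⟨s, hs⟩ := exists_map_unip_eq ε_u a
    apply lower_left_eq_zero_of_mul_unip (s := s)
    rw [hM, ← hs, ← ε_u, ← map_mul, ← map_mul, ← map_mul, ← map_mul, torus_mul_unip, mul_one]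
  obtain ⟨t, b, hMb⟩ := exists_mk_eq_unip_mul_torus hM0
  have hb : b ≠ 1 := by
    rintro rfl
    have hcomm : ε (mk (torus a) * mk (unip 1)) = ε (mk (unip 1) * mk (torus a)) := by
      rw [map_mul, map_mul, ← hM, hMb, ε_u, ← mkTorus_apply, map_one, mul_one, ← map_mul,
        ← map_mul, ← unip_add, ← unip_add, add_comm]
    have h := ε_inj hcomm
    rw [← map_mul, torus_mul_unip, map_mul] at h
    have := mk_unip_injective (mul_right_cancel h)
    exact ha1 (Units.val_eq_one.1 (by simpa using this))
  obtain ⟨r, hr⟩ := exists_unip_conj_torus t hb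
  -- A further conjugation by a unipotent element makes the torus invariant.
  let η : PGL(2, F) →* PGL(2, F) := (MulAut.conj (mk (unip r))⁻¹).toMonoidHom.comp ε
  have hη (x) : η x = (mk (unip r))⁻¹ * ε x * mk (unip r) := by simp [η]
  have η_inj : Function.Injective η := (MulAut.conj (mk (unip r))⁻¹).injective.comp ε_inj
  have η_u : η (mk (unip 1)) = mk (unip 1) := by
    rw [hη, ε_u, mul_assoc, ← map_mul, ← unip_add, add_comm, unip_add, map_mul,
      inv_mul_cancel_left]
  have η_a : η (mkTorus a) = mkTorus b := by
    rw [hη, mkTorus_apply, ← hM, hMb, mul_assoc, ← map_mul, ← map_mul, hr, map_mul,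
      inv_mul_cancel_left, mkTorus_apply]
  have η_torus (c : Fˣ) : ∃ d, η (mk (torus c)) = mk (torus d) := by
    obtain ⟨n, rfl⟩ := Subgroup.mem_zpowers_iff.1 (ha c)
    refine ⟨b ^ n, ?_⟩
    rw [← mkTorus_apply, ← mkTorus_apply, map_zpow, map_zpow, η_a, map_zpow]
  obtain ⟨σ, hσ⟩ := exists_eq_map η_inj η_u η_torus hF
  refine ⟨(P * unip r)⁻¹, σ, fun x ↦ ?_⟩
  rw [← hσ, hη, hε, map_inv, map_mul]
  group

end PGL2

/-- Automorphisms of `PGL₂(F)` for a finite field `F` of odd order: every group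
automorphism `δ` of `PGL₂(F) = GL₂(F)/Z(GL₂(F))` is the composition of the automorphism
induced by applying a field automorphism `σ` entrywise and a conjugation by (the image of)
a matrix `g ∈ GL₂(F)`: for every `x ∈ GL₂(F)`, `δ [x] = [g]⁻¹ * [σ(x)] * [g]`. -/
theorem pgl2_automorphism_description {F : Type*} [Field F] [Fintype F]
    (hodd : Odd (Fintype.card F))
    (δ : (GL (Fin 2) F ⧸ Subgroup.center (GL (Fin 2) F)) ≃*
      (GL (Fin 2) F ⧸ Subgroup.center (GL (Fin 2) F))) :
    ∃ (g : GL (Fin 2) F) (σ : F ≃+* F),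
      ∀ x : GL (Fin 2) F,
        δ (QuotientGroup.mk x) =
          (QuotientGroup.mk g)⁻¹ *
            QuotientGroup.mk
              (Units.map ((RingHom.mapMatrix (σ.toRingHom) :
                Matrix (Fin 2) (Fin 2) F →+* Matrix (Fin 2) (Fin 2) F) : _ →* _) x) *
            QuotientGroup.mk g := by
  have h2 : (-1 : Fˣ) ≠ 1 := by
    intro h
    have hchar : ringChar F ≠ 2 := by
      rw [Ne, FiniteField.even_card_iff_char_two, ← Nat.even_iff, Nat.not_even_iff_odd]
      exact hodd
    exact Ring.neg_one_ne_one_of_char_ne_two hchar (by simpa using congrArg Units.val h)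
  let ε : ProjGenLinGroup (Fin 2) F ≃* ProjGenLinGroup (Fin 2) F := δ
  obtain ⟨g, σ, h⟩ := PGL2.exists_conj_map (δ := ε.toMonoidHom) ε.injective ⟨-1, h2⟩
  exact ⟨g, σ, fun x ↦ h (ProjGenLinGroup.mk x)⟩
end
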